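/- For every 1 < q ≤ 2 there exists a constant C_q > 0 such that for all positive integers N, m with 1 ≤ m < N^2 there is a linear map 𝒜 : M_N → ℝ^m with the following property: for every X ∈ M_N with ‖X‖_{S_1} ≤ 1 and every minimizer X* of the nuclear norm ‖Z‖_{S_1} over all Z ∈ M_N with 𝒜Z = 𝒜X, one has ‖X − X*‖_{S_q} ≤ C_q · min{1, N/m}^{1 − 1/q}. -/

import Mathlib

noncomputable def singVals {N : ℕ} (X : Matrix (Fin N) (Fin N) ℝ) : Fin N → ℝ :=
  fun i => Real.sqrt ((Matrix.isHermitian_conjTranspose_mul_self X).eigenvalues i)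

/-- The Schatten `p`-quasi-norm of a real `N × N` matrix. -/
noncomputable def schattenNorm {N : ℕ} (p : ℝ) (X : Matrix (Fin N) (Fin N) ℝ) : ℝ :=
  (∑ i, singVals X i ^ p) ^ (1 / p)

open Finset
open scoped BigOperators

/-- The pairing of a sign pattern with a real vector. -/
def signPairing {ι : Type*} [Fintype ι] (ε : ι → ℤˣ) (w : ι → ℝ) : ℝ :=
  ∑ i, ((ε i : ℤ) : ℝ) * w i

section Rademacher

variable {ι : Type*} [Fintype ι]

lemma signPairing_neg (ε : ι → ℤˣ) (w : ι → ℝ) : signPairing (-ε) w = -signPairing ε w := by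
  simp [signPairing]

variable [DecidableEq ι]

lemma expect_exp_signPairing_le (w : ι → ℝ) :
    𝔼 ε : ι → ℤˣ, Real.exp (signPairing ε w) ≤ Real.exp ((∑ i, w i ^ 2) / 2) := by
  have h : ∑ ε : ι → ℤˣ, Real.exp (signPairing ε w) = ∏ i, (2 * Real.cosh (w i)) := by
    simp_rw [signPairing, Real.exp_sum]
    rw [← Fintype.prod_sum fun (i : ι) (e : ℤˣ) => Real.exp (((e : ℤ) : ℝ) * w i)]
    refine Finset.prod_congr rfl fun i _ => ?_
    rw [show (univ : Finset ℤˣ) = {1, -1} from rfl, Finset.sum_pair (by decide), Real.cosh_eq]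
    simp
    ring
  rw [Fintype.expect_eq_sum_div_card, h, Finset.prod_mul_distrib]
  simp only [prod_const, card_univ, Fintype.card_pi, Fintype.card_units_int, Nat.cast_pow,
    Nat.cast_ofNat]
  rw [mul_div_cancel_left₀ _ (by positivity), Finset.sum_div, Real.exp_sum]
  exact Finset.prod_le_prod (fun i _ => (Real.cosh_pos _).le) fun i _ =>
    Real.cosh_le_exp_half_sq _

lemma expect_cos_signPairing (w : ι → ℝ) :
    𝔼 ε : ι → ℤˣ, Real.cos (signPairing ε w) = ∏ i, Real.cos (w i) := by
  have h : ∑ ε : ι → ℤˣ, Complex.exp (signPairing ε w * Complex.I)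
      = ∏ i, (2 * Complex.cos (w i)) := by
    simp_rw [signPairing, Complex.ofReal_sum, Finset.sum_mul, Complex.exp_sum]
    rw [← Fintype.prod_sum fun (i : ι) (e : ℤˣ) =>
      Complex.exp (((((e : ℤ) : ℝ) * w i : ℝ) : ℂ) * Complex.I)]
    refine Finset.prod_congr rfl fun i _ => ?_
    rw [show (univ : Finset ℤˣ) = {1, -1} from rfl, Finset.sum_pair (by decide),
      Complex.two_cos]
    simp
  have h' : ∑ ε : ι → ℤˣ, Real.cos (signPairing ε w) =
      2 ^ Fintype.card ι * ∏ i, Real.cos (w i) := by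
    have h2 := congrArg Complex.re h
    rw [Complex.re_sum, Finset.prod_mul_distrib] at h2
    simp_rw [Complex.exp_ofReal_mul_I_re] at h2
    rw [h2]
    simp only [prod_const, card_univ, ← Complex.ofReal_cos, ← Complex.ofReal_prod]
    rw [← Complex.ofReal_re (2 ^ Fintype.card ι * ∏ i, Real.cos (w i))]
    push_cast
    rfl
  rw [Fintype.expect_eq_sum_div_card, h']
  simp only [Fintype.card_pi, Fintype.card_units_int, prod_const, card_univ, Nat.cast_pow,
    Nat.cast_ofNat]
  rw [mul_div_cancel_left₀ _ (by positivity)]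

lemma one_sub_cos_le_abs (t : ℝ) : 1 - Real.cos t ≤ |t| := by
  rcases le_total |t| 2 with h | h
  · have h1 := Real.one_sub_sq_div_two_le_cos (x := t)
    nlinarith [sq_abs t, abs_nonneg t]
  · linarith [Real.neg_one_le_cos t]

lemma cos_le_exp_neg_sq {x : ℝ} (hx : |x| ≤ 1) : Real.cos x ≤ Real.exp (-(2 / 5 * x ^ 2)) := by
  have h1 := (abs_le.1 (Real.cos_bound hx)).2
  have h2 := Real.add_one_le_exp (-(2 / 5 * x ^ 2))
  have h3 : |x| ^ 2 ≤ 1 := by nlinarith [abs_nonneg x]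
  have h4 : |x| ^ 4 ≤ x ^ 2 := by
    rw [← sq_abs x]; nlinarith [sq_nonneg |x|]
  linarith [sq_nonneg x]

/-- A Khintchine inequality: Rademacher sums have first moment comparable to the second. -/
lemma one_fourth_le_expect_abs_signPairing {w : ι → ℝ} (hw : ∑ i, w i ^ 2 = 1) :
    1 / 4 ≤ 𝔼 ε : ι → ℤˣ, |signPairing ε w| := by
  have hle : ∀ i, |w i| ≤ 1 := fun i => by
    rw [← sq_le_one_iff_abs_le_one, ← hw]
    exact Finset.single_le_sum (f := fun i => w i ^ 2) (fun j _ => sq_nonneg _) (mem_univ i)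
  have h1 : ∏ i, Real.cos (w i) ≤ Real.exp (-(2 / 5)) := by
    calc ∏ i, Real.cos (w i) ≤ ∏ i, Real.exp (-(2 / 5 * w i ^ 2)) :=
          Finset.prod_le_prod (fun i _ => Real.cos_nonneg_of_mem_Icc
            ⟨by linarith [(abs_le.1 (hle i)).1, Real.pi_gt_three],
             by linarith [(abs_le.1 (hle i)).2, Real.pi_gt_three]⟩)
            fun i _ => cos_le_exp_neg_sq (hle i)
      _ = Real.exp (-(2 / 5)) := by
          rw [← Real.exp_sum, Finset.sum_neg_distrib, ← Finset.mul_sum, hw, mul_one]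
  have h2 : Real.exp (-(2 / 5)) ≤ 3 / 4 := by
    rw [Real.exp_neg]
    have := Real.add_one_le_exp (2 / 5 : ℝ)
    exact inv_le_of_inv_le₀ (by norm_num) (by linarith)
  calc (1 : ℝ) / 4 ≤ 1 - ∏ i, Real.cos (w i) := by linarith
    _ = 𝔼 ε : ι → ℤˣ, (1 - Real.cos (signPairing ε w)) := by
        rw [Finset.expect_sub_distrib, expect_cos_signPairing, Fintype.expect_const]
    _ ≤ _ := Finset.expect_le_expect fun ε _ => one_sub_cos_le_abs _

end Rademacher

section Symmetrization

variable {Ω I : Type*} [Fintype Ω] [Finite I]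

lemma le_ciSup_of_finite (f : I → ℝ) (v : I) : f v ≤ ⨆ v, f v :=
  le_ciSup (Finite.bddAbove_range f) v

variable [Nonempty I]

/-- The contraction principle for one random sign and the absolute value. -/
lemma ciSup_add_abs_add_ciSup_sub_abs_le (a t : I → ℝ) :
    (⨆ v, (a v + |t v|)) + (⨆ v, (a v - |t v|)) ≤ (⨆ v, (a v + t v)) + ⨆ v, (a v - t v) := by
  obtain ⟨v, hv⟩ := exists_eq_ciSup_of_finite (f := fun v => a v + |t v|)
  obtain ⟨u, hu⟩ := exists_eq_ciSup_of_finite (f := fun v => a v - |t v|)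
  rw [← hv, ← hu]
  have h1 := le_ciSup_of_finite (fun v => a v + t v) v
  have h2 := le_ciSup_of_finite (fun v => a v + t v) u
  have h3 := le_ciSup_of_finite (fun v => a v - t v) v
  have h4 := le_ciSup_of_finite (fun v => a v - t v) u
  rcases abs_cases (t v) with h | h <;> linarith [le_abs_self (t u), neg_abs_le (t u)]

/-- Symmetrization and contraction for a single symmetric random variable. -/
lemma expect_ciSup_sub_abs_le [Nonempty Ω] [DecidableEq Ω] [InvolutiveNeg Ω] (t : Ω → I → ℝ)
    (ht : ∀ ω v, t (-ω) v = -t ω v) (a : I → ℝ) :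
    𝔼 ω, (⨆ v, (a v + ((𝔼 ω', |t ω' v|) - |t ω v|))) ≤ 𝔼 ω, ⨆ v, (a v + 2 * t ω v) := by
  have h1 : (⨆ v, (a v + 2 * 𝔼 ω', |t ω' v|)) ≤ 𝔼 ω, ⨆ v, (a v + |2 * t ω v|) := by
    refine ciSup_le fun v => ?_
    calc a v + 2 * 𝔼 ω', |t ω' v| = 𝔼 ω, (a v + |2 * t ω v|) := by
          simp [abs_mul, Finset.expect_add_distrib, Finset.mul_expect]
      _ ≤ _ := Finset.expect_le_expect fun ω _ =>
          le_ciSup_of_finite (fun v => a v + |2 * t ω v|) v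
  have h2 : 𝔼 ω, (⨆ v, (a v - 2 * t ω v)) = 𝔼 ω, ⨆ v, (a v + 2 * t ω v) := by
    refine Fintype.expect_equiv (Equiv.neg Ω) _ _ fun ω => ?_
    simp [ht, sub_eq_add_neg]
  have h3 := Finset.expect_le_expect (s := univ) fun ω _ =>
    ciSup_add_abs_add_ciSup_sub_abs_le a (fun v => 2 * t ω v)
  rw [Finset.expect_add_distrib, Finset.expect_add_distrib, h2] at h3
  have h4 : 𝔼 ω, (⨆ v, (a v + ((𝔼 ω', |t ω' v|) - |t ω v|))) ≤
      𝔼 ω, (1 / 2 * (⨆ v, (a v + 2 * 𝔼 ω', |t ω' v|)) + 1 / 2 * ⨆ v, (a v - |2 * t ω v|)) := by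
    refine Finset.expect_le_expect fun ω _ => ciSup_le fun v => ?_
    have e1 := le_ciSup_of_finite (fun v => a v + 2 * 𝔼 ω', |t ω' v|) v
    have e2 := le_ciSup_of_finite (fun v => a v - |2 * t ω v|) v
    simp only [abs_mul, abs_two] at e2 ⊢
    linarith
  rw [Finset.expect_add_distrib, Fintype.expect_const, ← Finset.mul_expect] at h4
  linarith

lemma expect_fin_succ {m : ℕ} (f : (Fin (m + 1) → Ω) → ℝ) :
    𝔼 A, f A = 𝔼 ω, 𝔼 A : Fin m → Ω, f (Fin.cons ω A) := by
  rw [← Finset.expect_product', Finset.univ_product_univ]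
  exact (Fintype.expect_equiv (Fin.consEquiv fun _ => Ω) _ _ fun _ => rfl).symm

/-- Symmetrization and contraction for independent copies of a symmetric random variable. -/
lemma expect_ciSup_sum_sub_abs_le [Nonempty Ω] [DecidableEq Ω] [InvolutiveNeg Ω] (t : Ω → I → ℝ)
    (ht : ∀ ω v, t (-ω) v = -t ω v) (m : ℕ) (a : I → ℝ) :
    𝔼 A : Fin m → Ω, (⨆ v, (a v + ∑ i, ((𝔼 ω', |t ω' v|) - |t (A i) v|))) ≤
      𝔼 A : Fin m → Ω, ⨆ v, (a v + ∑ i, 2 * t (A i) v) := by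
  induction m generalizing a with
  | zero => simp
  | succ m ih =>
    rw [expect_fin_succ, expect_fin_succ]
    simp only [Fin.sum_univ_succ, Fin.cons_zero, Fin.cons_succ]
    calc _ ≤ 𝔼 ω, 𝔼 A : Fin m → Ω,
          ⨆ v, (a v + ((𝔼 ω', |t ω' v|) - |t ω v|) + ∑ i, 2 * t (A i) v) :=
          Finset.expect_le_expect fun ω _ => by
            simpa only [add_assoc] using ih fun v => a v + ((𝔼 ω', |t ω' v|) - |t ω v|)
      _ = 𝔼 A : Fin m → Ω, 𝔼 ω,
          ⨆ v, (a v + ∑ i, 2 * t (A i) v + ((𝔼 ω', |t ω' v|) - |t ω v|)) := by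
          rw [Finset.expect_comm]; simp only [add_right_comm]
      _ ≤ 𝔼 A : Fin m → Ω, 𝔼 ω, ⨆ v, (a v + ∑ i, 2 * t (A i) v + 2 * t ω v) :=
          Finset.expect_le_expect fun A _ => expect_ciSup_sub_abs_le t ht _
      _ = _ := by
          rw [Finset.expect_comm]
          simp only [add_assoc, add_comm (2 * t _ _)]

end Symmetrization

section MaximalInequality

variable {ι I : Type*} [Fintype ι] [DecidableEq ι] [Fintype I] [Nonempty I]

lemma expect_exp_sum_signPairing_le (m : ℕ) (w : ι → ℝ) :
    𝔼 A : Fin m → ι → ℤˣ, Real.exp (∑ i, signPairing (A i) w) ≤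
      Real.exp (m * ((∑ i, w i ^ 2) / 2)) := by
  simp_rw [Real.exp_sum]
  rw [← Fintype.piFinset_univ, ← Finset.expect_pow univ (fun ε => Real.exp (signPairing ε w)),
    Real.exp_nat_mul]
  exact pow_le_pow_left₀ (Finset.expect_nonneg fun _ _ => (Real.exp_pos _).le)
    (expect_exp_signPairing_le w) m

/-- The expected maximum of finitely many Rademacher sums. -/
lemma mul_expect_ciSup_sum_signPairing_le (m : ℕ) (w : I → ι → ℝ) {R l b : ℝ}
    (hw : ∀ v, ∑ i, w v i ^ 2 ≤ R)
    (hb : Fintype.card I * Real.exp (m * (l ^ 2 * R / 2)) ≤ Real.exp b) :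
    l * 𝔼 A : Fin m → ι → ℤˣ, (⨆ v, ∑ i, signPairing (A i) (w v)) ≤ b := by
  have hpt : ∀ A : Fin m → ι → ℤˣ, l * (⨆ v, ∑ i, signPairing (A i) (w v)) ≤
      b - 1 + ∑ v, Real.exp (∑ i, signPairing (A i) (l • w v)) * Real.exp (-b) := fun A => by
    obtain ⟨v, hv⟩ := exists_eq_ciSup_of_finite (f := fun v => ∑ i, signPairing (A i) (w v))
    rw [← hv]
    have h1 : l * ∑ i, signPairing (A i) (w v) = ∑ i, signPairing (A i) (l • w v) := by
      simp only [signPairing, Finset.mul_sum, Pi.smul_apply, smul_eq_mul]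
      exact Finset.sum_congr rfl fun i _ => Finset.sum_congr rfl fun j _ => by ring
    have h2 := Real.add_one_le_exp (∑ i, signPairing (A i) (l • w v) + -b)
    rw [Real.exp_add] at h2
    have h3 := Finset.single_le_sum
      (f := fun v => Real.exp (∑ i, signPairing (A i) (l • w v)) * Real.exp (-b))
      (fun v _ => by positivity) (mem_univ v)
    linarith
  have h := Finset.expect_le_expect (s := univ) fun A _ => hpt A
  rw [← Finset.mul_expect, Finset.expect_add_distrib, Fintype.expect_const,
    Finset.expect_sum_comm] at h
  have h4 : ∑ v, 𝔼 A : Fin m → ι → ℤˣ, Real.exp (∑ i, signPairing (A i) (l • w v)) *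
      Real.exp (-b) ≤ ∑ _v : I, Real.exp (m * (l ^ 2 * R / 2)) * Real.exp (-b) := by
    refine Finset.sum_le_sum fun v _ => ?_
    rw [← Finset.expect_mul]
    gcongr
    refine (expect_exp_sum_signPairing_le m _).trans ?_
    gcongr
    simp only [Pi.smul_apply, smul_eq_mul, mul_pow, ← Finset.mul_sum]
    gcongr
    exact hw v
  have h5 : ∑ _v : I, Real.exp (m * (l ^ 2 * R / 2)) * Real.exp (-b) ≤ 1 := by
    rw [Finset.sum_const, card_univ, nsmul_eq_mul, ← mul_assoc]
    calc _ ≤ Real.exp b * Real.exp (-b) := by gcongr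
      _ = 1 := by rw [← Real.exp_add]; simp
  linarith

end MaximalInequality

section NuclearNorm

open Matrix

variable {N : ℕ}

lemma singVals_nonneg (X : Matrix (Fin N) (Fin N) ℝ) (i : Fin N) : 0 ≤ singVals X i :=
  Real.sqrt_nonneg _

lemma singVals_sq (X : Matrix (Fin N) (Fin N) ℝ) (i : Fin N) :
    singVals X i ^ 2 = (isHermitian_conjTranspose_mul_self X).eigenvalues i :=
  Real.sq_sqrt ((posSemidef_conjTranspose_mul_self X).eigenvalues_nonneg i)

lemma schattenNorm_one (X : Matrix (Fin N) (Fin N) ℝ) : schattenNorm 1 X = ∑ i, singVals X i := by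
  simp [schattenNorm]

/-- The orthonormal basis of right singular vectors of a matrix. -/
noncomputable def rightSingBasis (X : Matrix (Fin N) (Fin N) ℝ) :
    OrthonormalBasis (Fin N) ℝ (EuclideanSpace ℝ (Fin N)) :=
  (isHermitian_conjTranspose_mul_self X).eigenvectorBasis

lemma inner_toEuclideanCLM_toEuclideanCLM (S X : Matrix (Fin N) (Fin N) ℝ)
    (x y : EuclideanSpace ℝ (Fin N)) :
    inner ℝ (toEuclideanCLM (𝕜 := ℝ) S x) (toEuclideanCLM (𝕜 := ℝ) X y) =
      inner ℝ x (toEuclideanCLM (𝕜 := ℝ) (Sᴴ * X) y) := by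
  rw [map_mul, ← star_eq_conjTranspose, map_star, ContinuousLinearMap.star_eq_adjoint,
    mul_apply_eq_comp, ContinuousLinearMap.adjoint_inner_right]

lemma inner_toEuclideanCLM_rightSingBasis (X : Matrix (Fin N) (Fin N) ℝ) (j k : Fin N) :
    inner ℝ (toEuclideanCLM (𝕜 := ℝ) X (rightSingBasis X j))
      (toEuclideanCLM (𝕜 := ℝ) X (rightSingBasis X k)) =
      if j = k then singVals X k ^ 2 else 0 := by
  have h : toEuclideanCLM (𝕜 := ℝ) (Xᴴ * X) (rightSingBasis X k) =
      (singVals X k ^ 2) • rightSingBasis X k := by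
    rw [singVals_sq]
    apply WithLp.ofLp_injective
    rw [ofLp_toEuclideanCLM]
    exact (isHermitian_conjTranspose_mul_self X).mulVec_eigenvectorBasis k
  rw [inner_toEuclideanCLM_toEuclideanCLM, h, inner_smul_right,
    orthonormal_iff_ite.1 (rightSingBasis X).orthonormal]
  simp

lemma norm_toEuclideanCLM_rightSingBasis (X : Matrix (Fin N) (Fin N) ℝ) (j : Fin N) :
    ‖toEuclideanCLM (𝕜 := ℝ) X (rightSingBasis X j)‖ = singVals X j := by
  have h := inner_toEuclideanCLM_rightSingBasis X j j
  rw [real_inner_self_eq_norm_sq, if_pos rfl] at h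
  exact (sq_eq_sq₀ (norm_nonneg _) (singVals_nonneg X j)).1 h

lemma sum_inner_toEuclideanCLM (S X : Matrix (Fin N) (Fin N) ℝ)
    (b : OrthonormalBasis (Fin N) ℝ (EuclideanSpace ℝ (Fin N))) :
    ∑ j, inner ℝ (toEuclideanCLM (𝕜 := ℝ) S (b j)) (toEuclideanCLM (𝕜 := ℝ) X (b j)) =
      ∑ p : Fin N × Fin N, S p.1 p.2 * X p.1 p.2 := by
  simp_rw [inner_toEuclideanCLM_toEuclideanCLM]
  have h1 := LinearMap.trace_eq_sum_inner (toEuclideanLin (Sᴴ * X)) b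
  have h2 := LinearMap.trace_eq_sum_inner (toEuclideanLin (Sᴴ * X))
    (EuclideanSpace.basisFun (Fin N) ℝ)
  refine (h1.symm.trans h2).trans ?_
  rw [Fintype.sum_prod_type, Finset.sum_comm]
  refine Finset.sum_congr rfl fun j _ => ?_
  rw [EuclideanSpace.basisFun_apply, EuclideanSpace.inner_single_left]
  simp [toLpLin_apply, mulVec, dotProduct]

lemma sum_singVals_sq (X : Matrix (Fin N) (Fin N) ℝ) :
    ∑ j, singVals X j ^ 2 = ∑ p : Fin N × Fin N, X p.1 p.2 ^ 2 := by
  have h := sum_inner_toEuclideanCLM X X (rightSingBasis X)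
  simp only [inner_toEuclideanCLM_rightSingBasis, if_true] at h
  simpa only [pow_two] using h

/-- Trace duality between a matrix bounded by `K` on unit vectors and the nuclear norm. -/
lemma sum_mul_le_mul_schattenNorm_one (S X : Matrix (Fin N) (Fin N) ℝ) {K : ℝ}
    (hS : ‖toEuclideanCLM (n := Fin N) (𝕜 := ℝ) S‖ ≤ K) :
    ∑ p : Fin N × Fin N, S p.1 p.2 * X p.1 p.2 ≤ K * schattenNorm 1 X := by
  rw [← sum_inner_toEuclideanCLM S X (rightSingBasis X), schattenNorm_one, Finset.mul_sum]
  refine Finset.sum_le_sum fun j _ => (real_inner_le_norm _ _).trans ?_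
  rw [norm_toEuclideanCLM_rightSingBasis]
  gcongr
  · exact singVals_nonneg X j
  · refine (ContinuousLinearMap.le_of_opNorm_le _ hS _).trans ?_
    simp [(rightSingBasis X).orthonormal.1 j]

lemma exists_norming_matrix (X : Matrix (Fin N) (Fin N) ℝ) :
    ∃ Z : Matrix (Fin N) (Fin N) ℝ, ‖toEuclideanCLM (n := Fin N) (𝕜 := ℝ) Z‖ ≤ 1 ∧
      ∑ p : Fin N × Fin N, Z p.1 p.2 * X p.1 p.2 = schattenNorm 1 X := by
  set b := rightSingBasis X with hb
  set T := toEuclideanCLM (n := Fin N) (𝕜 := ℝ) X with hT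
  let U : EuclideanSpace ℝ (Fin N) →L[ℝ] EuclideanSpace ℝ (Fin N) :=
    ∑ j, (singVals X j)⁻¹ • (innerSL ℝ (b j)).smulRight (T (b j))
  have hU : ∀ x, U x = ∑ j, ((singVals X j)⁻¹ * inner ℝ (b j) x) • T (b j) := fun x => by
    simp [U, smul_smul]
  obtain ⟨Z, hZ⟩ : ∃ Z, toEuclideanCLM (n := Fin N) (𝕜 := ℝ) Z = U :=
    (toEuclideanCLM (n := Fin N) (𝕜 := ℝ)).surjective U
  refine ⟨Z, ?_, ?_⟩
  · rw [hZ]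
    refine ContinuousLinearMap.opNorm_le_bound _ zero_le_one fun x => ?_
    rw [one_mul]
    refine (sq_le_sq₀ (norm_nonneg _) (norm_nonneg _)).1 ?_
    rw [← real_inner_self_eq_norm_sq, hU, ← b.sum_sq_norm_inner_right x, sum_inner]
    refine Finset.sum_le_sum fun k _ => ?_
    simp only [inner_sum, inner_smul_left, inner_smul_right, hT, hb,
      inner_toEuclideanCLM_rightSingBasis]
    simp only [mul_ite, mul_zero, Finset.sum_ite_eq, mem_univ, if_true]
    by_cases h : singVals X k = 0
    · simp [h, sq_nonneg]
    · simp; field_simp; rfl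
  · rw [← sum_inner_toEuclideanCLM Z X b, schattenNorm_one, hZ]
    refine Finset.sum_congr rfl fun k _ => ?_
    rw [hU]
    simp only [orthonormal_iff_ite.1 b.orthonormal]
    simp only [mul_ite, mul_one, mul_zero, ite_smul, zero_smul, Finset.sum_ite_eq', mem_univ,
      if_true, inner_smul_left]
    rw [inner_toEuclideanCLM_rightSingBasis]
    by_cases h : singVals X k = 0
    · simp [h]
    · simp; field_simp

lemma schattenNorm_one_sub_le (X Y : Matrix (Fin N) (Fin N) ℝ) :
    schattenNorm 1 (X - Y) ≤ schattenNorm 1 X + schattenNorm 1 Y := by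
  obtain ⟨Z, hZ, hXY⟩ := exists_norming_matrix (X - Y)
  have h1 := sum_mul_le_mul_schattenNorm_one Z X hZ
  have h2 := sum_mul_le_mul_schattenNorm_one (-Z) Y (K := 1) (by rwa [map_neg, norm_neg])
  rw [← hXY]
  simp only [Matrix.sub_apply, Matrix.neg_apply, mul_sub, neg_mul, Finset.sum_sub_distrib,
    Finset.sum_neg_distrib] at *
  linarith

end NuclearNorm

section Net

/-- A finite `1`-net of the ball of radius `2` with at most `5 ^ dim` points. -/
lemma exists_one_net_closedBall_two (E : Type*) [NormedAddCommGroup E] [NormedSpace ℝ E]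
    [FiniteDimensional ℝ E] :
    ∃ s : Finset E, (∀ c ∈ s, ‖c‖ ≤ 2) ∧ s.card ≤ 5 ^ Module.finrank ℝ E ∧
      ∀ x : E, ‖x‖ ≤ 2 → ∃ c ∈ s, ‖x - c‖ ≤ 1 := by
  classical
  let P : Finset E → Prop := fun s => (∀ c ∈ s, ‖c‖ ≤ 2) ∧
    ∀ c ∈ s, ∀ d ∈ s, c ≠ d → 1 ≤ ‖c - d‖
  have hP : ∀ s, P s → s.card ≤ 5 ^ Module.finrank ℝ E := fun s hs =>
    Besicovitch.card_le_of_separated s hs.1 hs.2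
  let Q : ℕ → Prop := fun k => ∃ s, P s ∧ s.card = k
  have hQ0 : Q 0 := ⟨∅, ⟨by simp, by simp⟩, rfl⟩
  obtain ⟨s, hs, hcard⟩ : Q (Nat.findGreatest Q (5 ^ Module.finrank ℝ E)) :=
    Nat.findGreatest_spec (Nat.zero_le _) hQ0
  refine ⟨s, hs.1, hP s hs, fun x hx => ?_⟩
  by_contra! hfar
  have hxs : x ∉ s := fun h => by have := hfar x h; simp at this; linarith
  have hins : P (insert x s) := by
    refine ⟨fun c hc => ?_, fun c hc d hd hcd => ?_⟩
    · rcases Finset.mem_insert.1 hc with rfl | hc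
      exacts [hx, hs.1 c hc]
    · rcases Finset.mem_insert.1 hc with rfl | hc' <;>
        rcases Finset.mem_insert.1 hd with rfl | hd'
      · exact absurd rfl hcd
      · exact (hfar d hd').le
      · rw [norm_sub_rev]; exact (hfar c hc').le
      · exact hs.2 c hc' d hd' hcd
  have := Nat.le_findGreatest (P := Q) (hP _ hins) ⟨_, hins, rfl⟩
  rw [Finset.card_insert_of_notMem hxs] at this
  omega

/-- The operator norm is controlled by the values of the bilinear form on a net. -/
lemma opNorm_le_of_net {E : Type*} [NormedAddCommGroup E] [InnerProductSpace ℝ E]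
    {s : Finset E} (hs : ∀ x : E, ‖x‖ ≤ 2 → ∃ c ∈ s, ‖x - c‖ ≤ 1) (T : E →L[ℝ] E) {M : ℝ}
    (hM : ∀ c ∈ s, ∀ d ∈ s, inner ℝ d (T c) ≤ M) : ‖T‖ ≤ M := by
  have key : ∀ y : E, ∃ x : E, ‖x‖ ≤ 2 ∧ y = (‖y‖ / 2) • x := fun y => by
    by_cases hy : ‖y‖ = 0
    · exact ⟨0, by simp, by simpa using hy⟩
    · refine ⟨(2 / ‖y‖) • y, ?_, ?_⟩
      · rw [norm_smul, norm_div, norm_norm]; simp [hy]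
      · rw [smul_smul]; field_simp; simp
  have h1 : ∀ c ∈ s, ‖T c‖ ≤ M := fun c hc => by
    obtain ⟨x, hx, hxy⟩ := key (T c)
    obtain ⟨d, hd, hxd⟩ := hs x hx
    have e1 : inner ℝ (x - d) (T c) ≤ ‖T c‖ :=
      (real_inner_le_norm _ _).trans (mul_le_of_le_one_left (norm_nonneg _) hxd)
    have e2 : ‖T c‖ / 2 * inner ℝ x (T c) = ‖T c‖ ^ 2 := by
      rw [← real_inner_self_eq_norm_sq, ← real_inner_smul_left, ← hxy]
    rw [inner_sub_left] at e1
    have e3 := hM c hc d hd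
    rcases (norm_nonneg (T c)).eq_or_lt with h0 | h0
    · have : T c = 0 := norm_eq_zero.1 h0.symm
      simpa [this] using e3
    · have : inner ℝ x (T c) = 2 * ‖T c‖ := by
        have := mul_left_cancel₀ h0.ne' (b := inner ℝ x (T c)) (c := 2 * ‖T c‖) (by linarith)
        exact this
      linarith
  have hM0 : 0 ≤ M := by
    obtain ⟨c, hc, -⟩ := hs 0 (by simp)
    exact (norm_nonneg _).trans (h1 c hc)
  have h2 : ‖T‖ ≤ (M + ‖T‖) / 2 := by
    refine ContinuousLinearMap.opNorm_le_bound _ (by positivity) fun y => ?_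
    obtain ⟨x, hx, hxy⟩ := key y
    obtain ⟨c, hc, hxc⟩ := hs x hx
    have e1 : ‖T x‖ ≤ M + ‖T‖ := by
      calc ‖T x‖ = ‖T c + T (x - c)‖ := by rw [← map_add]; simp
        _ ≤ ‖T c‖ + ‖T (x - c)‖ := norm_add_le _ _
        _ ≤ M + ‖T‖ := add_le_add (h1 c hc) (T.unit_le_opNorm _ hxc)
    calc ‖T y‖ = ‖y‖ / 2 * ‖T x‖ := by
          conv_lhs => rw [hxy, map_smul, norm_smul]
          simp
      _ ≤ ‖y‖ / 2 * (M + ‖T‖) := by gcongr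
      _ = _ := by ring
  linarith

end Net

section GelfandWidth

open Matrix

variable {N : ℕ}

/-- The sum of `m` sign matrices. -/
def signMatrixSum {m : ℕ} (A : Fin m → Fin N × Fin N → ℤˣ) : Matrix (Fin N) (Fin N) ℝ :=
  Matrix.of fun a b => ∑ i, ((A i (a, b) : ℤ) : ℝ)

lemma sum_signPairing {m : ℕ} (A : Fin m → Fin N × Fin N → ℤˣ) (w : Fin N × Fin N → ℝ) :
    ∑ i, signPairing (A i) w = ∑ p : Fin N × Fin N, signMatrixSum A p.1 p.2 * w p := by
  simp only [signPairing, signMatrixSum, Matrix.of_apply, Finset.sum_mul]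
  rw [Finset.sum_comm]

/-- The expected operator norm of a sum of `m` independent random sign matrices. -/
lemma expect_opNorm_signMatrixSum_le {m : ℕ} (hN : 0 < N) (hm : 0 < m) :
    𝔼 A : Fin m → Fin N × Fin N → ℤˣ,
      ‖toEuclideanCLM (n := Fin N) (𝕜 := ℝ) (signMatrixSum A)‖ ≤ 16 * √(m * N) := by
  obtain ⟨s, hs2, hcard, hnet⟩ := exists_one_net_closedBall_two (EuclideanSpace ℝ (Fin N))
  rw [finrank_euclideanSpace_fin] at hcard
  have hne : Nonempty s := by
    obtain ⟨c, hc, -⟩ := hnet 0 (by simp)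
    exact ⟨⟨c, hc⟩⟩
  let w : s × s → Fin N × Fin N → ℝ := fun v p => v.2.1 p.1 * v.1.1 p.2
  have hw : ∀ v, ∑ p, w v p ^ 2 ≤ 16 := fun v => by
    have h1 : ∑ p, w v p ^ 2 = ‖v.2.1‖ ^ 2 * ‖v.1.1‖ ^ 2 := by
      simp only [w, mul_pow, EuclideanSpace.real_norm_sq_eq, Fintype.sum_prod_type,
        Finset.sum_mul_sum]
    rw [h1]
    nlinarith [hs2 _ v.1.2, hs2 _ v.2.2, norm_nonneg v.1.1, norm_nonneg v.2.1,
      pow_le_pow_left₀ (norm_nonneg _) (hs2 _ v.1.2) 2,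
      pow_le_pow_left₀ (norm_nonneg _) (hs2 _ v.2.2) 2, sq_nonneg ‖v.1.1‖]
  have hop : ∀ A : Fin m → Fin N × Fin N → ℤˣ,
      ‖toEuclideanCLM (n := Fin N) (𝕜 := ℝ) (signMatrixSum A)‖ ≤
        ⨆ v, ∑ i, signPairing (A i) (w v) := fun A => by
    refine opNorm_le_of_net hnet _ fun c hc d hd => ?_
    refine le_trans (le_of_eq ?_)
      (le_ciSup_of_finite (fun v => ∑ i, signPairing (A i) (w v)) (⟨c, hc⟩, ⟨d, hd⟩))
    rw [inner_toEuclideanCLM, sum_signPairing, Fintype.sum_prod_type]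
    simp only [dotProduct, mulVec, Finset.mul_sum, w]
    exact Finset.sum_congr rfl fun a _ => Finset.sum_congr rfl fun b _ => by ring
  refine (Finset.expect_le_expect fun A _ => hop A).trans ?_
  have hN' : (0 : ℝ) < N := Nat.cast_pos.2 hN
  have hm' : (0 : ℝ) < m := Nat.cast_pos.2 hm
  set l : ℝ := √(m * N) / (4 * m) with hl
  have hl0 : 0 < l := by positivity
  have hsq : √(m * N : ℝ) ^ 2 = m * N := Real.sq_sqrt (by positivity)
  have hl2 : (m : ℝ) * (l ^ 2 * 16 / 2) = N / 2 := by
    rw [hl, div_pow, hsq]; field_simp; norm_num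
  have hb : (Fintype.card (s × s) : ℝ) * Real.exp (m * (l ^ 2 * 16 / 2)) ≤ Real.exp (4 * N) := by
    have h1 : (Fintype.card (s × s) : ℝ) ≤ 25 ^ N := by
      rw [Fintype.card_prod, Fintype.card_coe]
      have : (s.card : ℝ) ≤ 5 ^ N := by exact_mod_cast hcard
      push_cast
      calc (s.card : ℝ) * s.card ≤ 5 ^ N * 5 ^ N := by gcongr
        _ = 25 ^ N := by rw [← mul_pow]; norm_num
    have h2 : (25 : ℝ) ≤ Real.exp (7 / 2) := by
      have h3 : Real.exp (7 / 2) ^ 2 = Real.exp 1 ^ 7 := by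
        rw [← Real.exp_nat_mul, ← Real.exp_nat_mul]; norm_num
      have h4 : (2.7 : ℝ) ^ 7 ≤ Real.exp 1 ^ 7 := by
        gcongr
        linarith [Real.exp_one_gt_d9]
      refine le_of_sq_le_sq ?_ (Real.exp_pos _).le
      rw [h3]
      exact le_trans (by norm_num) h4
    rw [hl2]
    calc _ ≤ Real.exp (7 / 2) ^ N * Real.exp (N / 2) := by
          gcongr; exact h1.trans (by gcongr)
      _ = Real.exp (4 * N) := by
          rw [← Real.exp_nat_mul, ← Real.exp_add]; congr 1; ring
  have h := mul_expect_ciSup_sum_signPairing_le m w hw hb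
  have h' := (le_div_iff₀' hl0).2 h
  refine h'.trans (le_of_eq ?_)
  rw [hl, div_eq_iff (by positivity)]
  calc 4 * (N : ℝ) = 4 / m * (m * N) := by field_simp
    _ = 4 / m * √(m * N : ℝ) ^ 2 := by rw [hsq]
    _ = _ := by ring

/-- There are `m` sign matrices such that any matrix orthogonal to all of them has Frobenius norm
bounded by a multiple of `√(N / m)` times its nuclear norm. -/
lemma exists_signs_frobenius_le {m : ℕ} (hN : 0 < N) (hm : 0 < m) :
    ∃ A : Fin m → Fin N × Fin N → ℤˣ, ∀ V : Matrix (Fin N) (Fin N) ℝ,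
      (∀ i, signPairing (A i) (fun p => V p.1 p.2) = 0) →
      ∑ j, singVals V j ^ 2 ≤ 200 ^ 2 * (N / m) * schattenNorm 1 V ^ 2 := by
  by_contra! hcon
  choose V hV0 hV using hcon
  have hN' : (0 : ℝ) < N := Nat.cast_pos.2 hN
  have hm' : (0 : ℝ) < m := Nat.cast_pos.2 hm
  let F : (Fin m → Fin N × Fin N → ℤˣ) → ℝ := fun B => √(∑ j, singVals (V B) j ^ 2)
  have hFpos : ∀ B, 0 < F B := fun B =>
    Real.sqrt_pos.2 (lt_of_le_of_lt (by positivity) (hV B))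
  have hFsq : ∀ B, F B ^ 2 = ∑ p : Fin N × Fin N, V B p.1 p.2 ^ 2 := fun B => by
    rw [← sum_singVals_sq]
    exact Real.sq_sqrt (Finset.sum_nonneg fun _ _ => sq_nonneg _)
  have hF : ∀ B, schattenNorm 1 (V B) ≤ √(m * N) / (200 * N) * F B := fun B => by
    have h1 : 0 ≤ √(m * N : ℝ) / (200 * N) * F B := by
      have := hFpos B
      positivity
    refine le_of_sq_le_sq ?_ h1
    have h2 : F B ^ 2 = ∑ j, singVals (V B) j ^ 2 := by rw [hFsq, sum_singVals_sq]
    rw [mul_pow, div_pow, Real.sq_sqrt (by positivity), h2]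
    have h3 := (hV B).le
    calc schattenNorm 1 (V B) ^ 2 = m * N / (200 * N) ^ 2 *
          (200 ^ 2 * (N / m) * schattenNorm 1 (V B) ^ 2) := by field_simp
      _ ≤ _ := by gcongr
  let W : (Fin m → Fin N × Fin N → ℤˣ) → Fin N × Fin N → ℝ := fun B p => V B p.1 p.2 / F B
  have hW : ∀ B, ∑ p, W B p ^ 2 = 1 := fun B => by
    simp only [W, div_pow, ← Finset.sum_div, ← hFsq]
    exact div_self (pow_ne_zero _ (hFpos B).ne')
  have hW0 : ∀ B i, signPairing (B i) (W B) = 0 := fun B i => by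
    have h := hV0 B i
    simp only [signPairing, W, ← mul_div_assoc, ← Finset.sum_div] at h ⊢
    rw [h, zero_div]
  have hdual : ∀ A B : Fin m → Fin N × Fin N → ℤˣ, ∑ i, 2 * signPairing (A i) (W B) ≤
      2 * (√(m * N) / (200 * N)) * ‖toEuclideanCLM (n := Fin N) (𝕜 := ℝ) (signMatrixSum A)‖ :=
    fun A B => by
      rw [← Finset.mul_sum, sum_signPairing, mul_assoc]
      refine mul_le_mul_of_nonneg_left ?_ zero_le_two
      simp only [W, ← mul_div_assoc, ← Finset.sum_div]
      rw [div_le_iff₀ (hFpos B)]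
      refine (sum_mul_le_mul_schattenNorm_one _ (V B) le_rfl).trans ?_
      calc _ ≤ ‖toEuclideanCLM (n := Fin N) (𝕜 := ℝ) (signMatrixSum A)‖ *
            (√(m * N) / (200 * N) * F B) := by gcongr; exact hF B
        _ = _ := by ring
  have hsymm := expect_ciSup_sum_sub_abs_le (Ω := Fin N × Fin N → ℤˣ)
    (fun ε B => signPairing ε (W B)) (fun ε B => signPairing_neg ε (W B)) m (fun _ => 0)
  simp only [zero_add] at hsymm
  have hlow : (m : ℝ) / 4 ≤ 𝔼 A : Fin m → Fin N × Fin N → ℤˣ,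
      ⨆ B, ∑ i, ((𝔼 ε, |signPairing ε (W B)|) - |signPairing (A i) (W B)|) := by
    rw [← Fintype.expect_const (ι := Fin m → Fin N × Fin N → ℤˣ) ((m : ℝ) / 4)]
    refine Finset.expect_le_expect fun A _ => le_trans ?_
      (le_ciSup_of_finite (fun B => ∑ i, ((𝔼 ε, |signPairing ε (W B)|) -
        |signPairing (A i) (W B)|)) A)
    simp only [hW0, abs_zero, sub_zero, Finset.sum_const, card_univ, Fintype.card_fin,
      nsmul_eq_mul]
    have := one_fourth_le_expect_abs_signPairing (hW A)
    calc (m : ℝ) / 4 = m * (1 / 4) := by ring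
      _ ≤ _ := by gcongr
  have hup : 𝔼 A : Fin m → Fin N × Fin N → ℤˣ, (⨆ B, ∑ i, 2 * signPairing (A i) (W B)) ≤
      2 * (√(m * N) / (200 * N)) * (16 * √(m * N)) := by
    refine (Finset.expect_le_expect fun A _ => ciSup_le fun B => hdual A B).trans ?_
    rw [← Finset.mul_expect]
    gcongr
    exact expect_opNorm_signMatrixSum_le hN hm
  have hfin : 2 * (√(m * N : ℝ) / (200 * N)) * (16 * √(m * N)) = 4 / 25 * m := by
    have hsq : √(m * N : ℝ) * √(m * N : ℝ) = m * N := Real.mul_self_sqrt (by positivity)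
    calc _ = 32 / (200 * N) * (√(m * N : ℝ) * √(m * N : ℝ)) := by ring
      _ = _ := by rw [hsq]; field_simp; norm_num
  linarith

end GelfandWidth

section Recovery

variable {N : ℕ}

/-- Interpolation between the nuclear and the Frobenius norm, at a scale `s`. -/
lemma schattenNorm_le_of_frobenius_le {q s K : ℝ} (hq1 : 1 < q) (hq2 : q ≤ 2) (hs : 0 < s)
    (V : Matrix (Fin N) (Fin N) ℝ) (h1 : schattenNorm 1 V ≤ 2)
    (h2 : ∑ j, singVals V j ^ 2 ≤ K * s) (hK : 0 ≤ K) :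
    schattenNorm q V ≤ (2 + K) ^ (1 / q) * s ^ (1 - 1 / q) := by
  have hpt : ∀ x : ℝ, 0 ≤ x → x ^ q ≤ s ^ (q - 1) * x + s ^ (q - 2) * x ^ 2 := fun x hx => by
    rcases hx.eq_or_lt with rfl | hx0
    · simp [Real.zero_rpow (by linarith : q ≠ 0)]
    rcases le_total x s with hxs | hxs
    · have : x ^ q = x ^ (q - 1) * x := by
        rw [← Real.rpow_add_one hx0.ne']; ring_nf
      have h3 : x ^ (q - 1) ≤ s ^ (q - 1) := Real.rpow_le_rpow hx hxs (by linarith)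
      have h4 : 0 ≤ s ^ (q - 2) * x ^ 2 := by positivity
      rw [this]
      nlinarith
    · have : x ^ q = x ^ (q - 2) * x ^ 2 := by
        rw [← Real.rpow_natCast x 2, ← Real.rpow_add hx0]; norm_num
      have h3 : x ^ (q - 2) ≤ s ^ (q - 2) :=
        Real.rpow_le_rpow_of_nonpos hs hxs (by linarith)
      have h4 : 0 ≤ s ^ (q - 1) * x := by positivity
      rw [this]
      nlinarith [sq_nonneg x]
  have hsum : ∑ j, singVals V j ^ q ≤ (2 + K) * s ^ (q - 1) := by
    calc ∑ j, singVals V j ^ q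
        ≤ ∑ j, (s ^ (q - 1) * singVals V j + s ^ (q - 2) * singVals V j ^ 2) :=
          Finset.sum_le_sum fun j _ => hpt _ (singVals_nonneg V j)
      _ = s ^ (q - 1) * schattenNorm 1 V + s ^ (q - 2) * ∑ j, singVals V j ^ 2 := by
          rw [Finset.sum_add_distrib, ← Finset.mul_sum, ← Finset.mul_sum, schattenNorm_one]
      _ ≤ s ^ (q - 1) * 2 + s ^ (q - 2) * (K * s) := by gcongr
      _ = (2 + K) * s ^ (q - 1) := by
          have : s ^ (q - 1) = s ^ (q - 2) * s := by
            rw [← Real.rpow_add_one hs.ne']; ring_nf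
          rw [this]; ring
  calc schattenNorm q V ≤ ((2 + K) * s ^ (q - 1)) ^ (1 / q) :=
        Real.rpow_le_rpow (Finset.sum_nonneg fun j _ =>
          Real.rpow_nonneg (singVals_nonneg V j) _) hsum (by positivity)
    _ = _ := by
        rw [Real.mul_rpow (by positivity) (by positivity), ← Real.rpow_mul hs.le]
        congr 2
        field_simp

/-- The measurement map given by a family of sign matrices. -/
def signMeasurement {m : ℕ} (A : Fin m → Fin N × Fin N → ℤˣ) :
    Matrix (Fin N) (Fin N) ℝ →ₗ[ℝ] EuclideanSpace ℝ (Fin m) where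
  toFun V := WithLp.toLp 2 fun i => signPairing (A i) fun p => V p.1 p.2
  map_add' V W := by
    ext i
    simp [signPairing, mul_add, Finset.sum_add_distrib]
  map_smul' c V := by
    ext i
    simp [signPairing, Finset.mul_sum, mul_left_comm]

end Recovery

/-- Upper bound for `p = 1`: there is a measurement map `𝒜 : M_N → ℝ^m` such that nuclear
norm minimization recovers every matrix in the Schatten `1`-ball up to error
`C_q min{1, N/m}^{1 - 1/q}` in the Schatten `q`-norm, for `1 < q ≤ 2`. -/
theorem recovery_upper_bound_nuclear_ball
    (q : ℝ) (hq1 : 1 < q) (hq2 : q ≤ 2) :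
    ∃ C : ℝ, 0 < C ∧
      ∀ N m : ℕ, 0 < N → 1 ≤ m → m < N ^ 2 →
        ∃ A : Matrix (Fin N) (Fin N) ℝ →ₗ[ℝ] EuclideanSpace ℝ (Fin m),
          ∀ X : Matrix (Fin N) (Fin N) ℝ, schattenNorm 1 X ≤ 1 →
            ∀ Xstar : Matrix (Fin N) (Fin N) ℝ, A Xstar = A X →
              (∀ Z : Matrix (Fin N) (Fin N) ℝ, A Z = A X →
                schattenNorm 1 Xstar ≤ schattenNorm 1 Z) →
              schattenNorm q (X - Xstar) ≤ C * (min 1 ((N : ℝ) / m)) ^ (1 - 1 / q) := by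
  refine ⟨(2 + 4 * 200 ^ 2) ^ (1 / q), by positivity, fun N m hN hm _ => ?_⟩
  obtain ⟨A, hA⟩ := exists_signs_frobenius_le hN hm
  refine ⟨signMeasurement A, fun X hX Xstar hXstar hmin => ?_⟩
  have hone : schattenNorm 1 (X - Xstar) ≤ 2 := by
    linarith [schattenNorm_one_sub_le X Xstar, hmin X rfl]
  have hone0 : 0 ≤ schattenNorm 1 (X - Xstar) := by
    rw [schattenNorm_one]
    exact Finset.sum_nonneg fun j _ => singVals_nonneg _ j
  have hsq : schattenNorm 1 (X - Xstar) ^ 2 ≤ 4 := by nlinarith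
  have hker : signMeasurement A (X - Xstar) = 0 := by rw [map_sub, hXstar, sub_self]
  have hfro := hA (X - Xstar) fun i => congrArg (fun y => y i) hker
  have hN' : (0 : ℝ) < N := Nat.cast_pos.2 hN
  have hm' : (0 : ℝ) < m := Nat.cast_pos.2 hm
  refine schattenNorm_le_of_frobenius_le hq1 hq2 (lt_min one_pos (by positivity)) _ hone ?_
    (by norm_num)
  rcases min_cases 1 ((N : ℝ) / m) with h | h
  · rw [h.1]
    have : ∑ j, singVals (X - Xstar) j ^ 2 ≤ schattenNorm 1 (X - Xstar) ^ 2 := by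
      rw [schattenNorm_one]
      exact Finset.sum_sq_le_sq_sum_of_nonneg fun j _ => singVals_nonneg _ j
    linarith
  · rw [h.1]
    calc _ ≤ _ := hfro
      _ ≤ 200 ^ 2 * (N / m) * 4 := by gcongr
      _ = _ := by ring
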